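/- Fix N ∈ ℕ, β ≥ 0, m ∈ (−1,1), and define G : ℝ^{N×N} → ℝ by G(g) := (1/N) log Σ_{σ∈{−1,1}^N} p_m(σ) exp((β/√2) Σ_{1≤i,j≤N} g_{ij} (σ_i−m)(σ_j−m) − (β²/(4N)) Σ_{1≤i,j≤N} (σ_i−m)²(σ_j−m)²). Then G is Lipschitz continuous with respect to the Euclidean norm on ℝ^{N×N} with Lipschitz constant at most β(1+|m|)²/√2. -/

import Mathlib

open MeasureTheory ProbabilityTheory Real Filter
open scoped NNReal

noncomputable section

/-- The law of the i.i.d. Gaussian couplings `(g_{ij})_{1 ≤ i,j ≤ N}`, each `N(0, 1/N)`. -/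
def couplings (N : ℕ) : Measure (Fin N × Fin N → ℝ) :=
  Measure.pi fun _ : Fin N × Fin N => gaussianReal 0 ((N : ℝ≥0))⁻¹

/-- The spin value (`±1`) encoded by a Boolean. -/
def spin (b : Bool) : ℝ := if b then 1 else -1

/-- The base product measure weight `p_m(σ) = ∏ i, (1 + m σ_i)/2`. -/
def pm (N : ℕ) (m : ℝ) (σ : Fin N → Bool) : ℝ :=
  ∏ i : Fin N, (1 + m * spin (σ i)) / 2

/-- The Hamiltonian `H_{N,β,m}(σ)`. -/
def ham (N : ℕ) (β m : ℝ) (g : Fin N × Fin N → ℝ) (σ : Fin N → Bool) : ℝ :=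
  (β / Real.sqrt 2) * ∑ i : Fin N, ∑ j : Fin N,
      g (i, j) * (spin (σ i) - m) * (spin (σ j) - m)
    - (β ^ 2 / (4 * N)) * ∑ i : Fin N, ∑ j : Fin N,
      (spin (σ i) - m) ^ 2 * (spin (σ j) - m) ^ 2

/-- The partition function `Z_{N,β,m}`. -/
def Z (N : ℕ) (β m : ℝ) (g : Fin N × Fin N → ℝ) : ℝ :=
  ∑ σ : Fin N → Bool, pm N m σ * Real.exp (ham N β m g σ)

/-- The set `S_{N,m,ε}` of configurations whose empirical magnetization is `ε`-close to `m`. -/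
def SNset (N : ℕ) (m ε : ℝ) : Finset (Fin N → Bool) :=
  Finset.univ.filter fun σ =>
    (N : ℝ)⁻¹ * (∑ i : Fin N, spin (σ i)) ∈ Set.Icc (m - ε) (m + ε)

/-- The restricted partition function `Z^{≤ε}_{N,β,m}`. -/
def Zres (N : ℕ) (β m ε : ℝ) (g : Fin N × Fin N → ℝ) : ℝ :=
  ∑ σ ∈ SNset N m ε, pm N m σ * Real.exp (ham N β m g σ)

/-- The quenched free energy `E[(1/N) log Z_{N,β,m}]`. -/
def F (N : ℕ) (β m : ℝ) : ℝ :=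
  ∫ g, (N : ℝ)⁻¹ * Real.log (Z N β m g) ∂(couplings N)

/-- The restricted quenched free energy `F^{≤ε}_{N,β,m} = E[(1/N) log Z^{≤ε}_{N,β,m}]`. -/
def Fres (N : ℕ) (β m ε : ℝ) : ℝ :=
  ∫ g, (N : ℝ)⁻¹ * Real.log (Zres N β m ε g) ∂(couplings N)

/-- The binary entropy function `I`. -/
def binEnt (s : ℝ) : ℝ :=
  -((1 + s) / 2) * Real.log ((1 + s) / 2) - ((1 - s) / 2) * Real.log ((1 - s) / 2)

/-- The centered Gaussian field `X_σ = (2N)^{-1/2} Σ_{ij} g_{ij} σ̂_i σ̂_j`. -/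
def Xg (N : ℕ) (m : ℝ) (g : Fin N × Fin N → ℝ) (σ : Fin N → Bool) : ℝ :=
  (Real.sqrt (2 * N))⁻¹ * ∑ i : Fin N, ∑ j : Fin N,
    g (i, j) * (spin (σ i) - m) * (spin (σ j) - m)

/-- The maximum `M_{N,m,ε} = max {X_σ : σ ∈ S_{N,m,ε}}`. -/
def Mmax (N : ℕ) (m ε : ℝ) (g : Fin N × Fin N → ℝ) : ℝ :=
  sSup ((fun σ => Xg N m g σ) '' (SNset N m ε : Set (Fin N → Bool)))

end

lemma abs_spin (b : Bool) : |spin b| = 1 := by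
  cases b <;> simp [spin]

lemma abs_spin_sub_le (b : Bool) (m : ℝ) : |spin b - m| ≤ 1 + |m| :=
  (abs_sub _ _).trans_eq (by rw [abs_spin])

lemma pm_pos (N : ℕ) {m : ℝ} (hm : m ∈ Set.Ioo (-1 : ℝ) 1) (σ : Fin N → Bool) :
    0 < pm N m σ := by
  refine Finset.prod_pos fun i _ => ?_
  obtain ⟨h₁, h₂⟩ := hm
  cases σ i <;> simp only [spin, if_true, Bool.false_eq_true, if_false] <;> linarith

lemma Z_pos (N : ℕ) (β : ℝ) {m : ℝ} (hm : m ∈ Set.Ioo (-1 : ℝ) 1) (g : Fin N × Fin N → ℝ) :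
    0 < Z N β m g :=
  Finset.sum_pos (fun σ _ => mul_pos (pm_pos N hm σ) (exp_pos _)) Finset.univ_nonempty

lemma ham_sub_ham (N : ℕ) (β m : ℝ) (g h : Fin N × Fin N → ℝ) (σ : Fin N → Bool) :
    ham N β m g σ - ham N β m h σ = β / √2 *
      ∑ p : Fin N × Fin N, (g p - h p) * ((spin (σ p.1) - m) * (spin (σ p.2) - m)) := by
  rw [ham, ham, sub_sub_sub_cancel_right, ← mul_sub, Fintype.sum_prod_type,
    ← Finset.sum_sub_distrib]
  congr 1
  refine Finset.sum_congr rfl fun i _ => ?_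
  rw [← Finset.sum_sub_distrib]
  exact Finset.sum_congr rfl fun j _ => by ring

/-- A bilinear form whose test vector has entries bounded by `B` is controlled by `N * B ^ 2`
times the Euclidean norm of its coefficients. -/
lemma sum_mul_mul_le (N : ℕ) (d : EuclideanSpace ℝ (Fin N × Fin N)) {a : Fin N → ℝ} {B : ℝ}
    (ha : ∀ i, |a i| ≤ B) (hB : 0 ≤ B) :
    ∑ p : Fin N × Fin N, d p * (a p.1 * a p.2) ≤ ‖d‖ * (N * B ^ 2) := by
  refine (Real.sum_mul_le_sqrt_mul_sqrt _ _ _).trans ?_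
  rw [EuclideanSpace.norm_eq]
  simp only [norm_eq_abs, sq_abs]
  gcongr
  refine Real.sqrt_le_iff.2 ⟨by positivity, ?_⟩
  have key : ∀ p ∈ Finset.univ, (a (p : Fin N × Fin N).1 * a p.2) ^ 2 ≤ (B ^ 2) ^ 2 := by
    intro p _
    rw [sq_le_sq, abs_mul, abs_of_nonneg (sq_nonneg B), sq]
    exact mul_le_mul (ha _) (ha _) (abs_nonneg _) hB
  refine (Finset.sum_le_card_nsmul _ _ _ key).trans_eq ?_
  simp only [Finset.card_univ, Fintype.card_prod, Fintype.card_fin, nsmul_eq_mul, Nat.cast_mul]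
  ring

lemma ham_le_add (N : ℕ) {β : ℝ} (m : ℝ) (hβ : 0 ≤ β) (g h : EuclideanSpace ℝ (Fin N × Fin N))
    (σ : Fin N → Bool) :
    ham N β m (fun p => g p) σ ≤
      ham N β m (fun p => h p) σ + N * (β * (1 + |m|) ^ 2 / √2 * dist g h) := by
  rw [← sub_le_iff_le_add', ham_sub_ham, dist_eq_norm]
  calc
    _ ≤ β / √2 * (‖g - h‖ * (N * (1 + |m|) ^ 2)) := by
      gcongr
      exact sum_mul_mul_le N (g - h) (a := fun i => spin (σ i) - m)
        (fun i => abs_spin_sub_le _ _) (by positivity)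
    _ = _ := by ring

lemma log_Z_le_add (N : ℕ) {β m : ℝ} (hm : m ∈ Set.Ioo (-1 : ℝ) 1) {g h : Fin N × Fin N → ℝ}
    {C : ℝ} (hC : ∀ σ, ham N β m g σ ≤ ham N β m h σ + C) :
    log (Z N β m g) ≤ log (Z N β m h) + C := by
  have hle : Z N β m g ≤ Z N β m h * exp C := by
    rw [Z, Z, Finset.sum_mul]
    refine Finset.sum_le_sum fun σ _ => ?_
    rw [mul_assoc, ← exp_add]
    exact mul_le_mul_of_nonneg_left (exp_le_exp.2 (hC σ)) (pm_pos N hm σ).le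
  calc
    log (Z N β m g) ≤ log (Z N β m h * exp C) := log_le_log (Z_pos N β hm g) hle
    _ = _ := by rw [log_mul (Z_pos N β hm h).ne' (exp_pos C).ne', log_exp]

/-- the map `g ↦ (1/N) log Z_{N,β,m}(g)` is Lipschitz on Euclidean space with
Lipschitz constant at most `β (1+|m|)² / √2`. -/
theorem statement17 (N : ℕ) (hN : 0 < N) (β m : ℝ) (hβ : 0 ≤ β)
    (hm : m ∈ Set.Ioo (-1 : ℝ) 1) :
    LipschitzWith (Real.toNNReal (β * (1 + |m|) ^ 2 / Real.sqrt 2))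
      (fun g : EuclideanSpace ℝ (Fin N × Fin N) =>
        (N : ℝ)⁻¹ * Real.log (Z N β m (fun p => g p))) := by
  refine LipschitzWith.of_le_add_mul' _ fun g h => ?_
  have hN' : (0 : ℝ) < N := Nat.cast_pos.2 hN
  have hlog := log_Z_le_add N hm (ham_le_add N m hβ g h)
  calc
    _ ≤ (N : ℝ)⁻¹ * (log (Z N β m fun p => h p) +
        N * (β * (1 + |m|) ^ 2 / √2 * dist g h)) := by gcongr
    _ = _ := by rw [mul_add, inv_mul_cancel_left₀ hN'.ne']
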